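/- Let Ψ be admissible and let k ≥ 0. Then there exists a smooth diffeomorphism f of ℝ^{2+k} such that: (i) f preserves Lebesgue measure on ℝ^{2+k}; (ii) f commutes with integer translations in the first two coordinates, i.e. f(x + p, y + q, u) = f(x, y, u) + (p, q, 0) for all integers p, q (so f descends to the manifold 𝕋² × ℝᵏ); and (iii) 0 < limsup_{n→∞} Γ_n(f) / Ψ(n) < ∞, where Γ_n(f) = max( sup_p ‖D_p f^n‖ , sup_p ‖D_p f^{−n}‖ ). -/

import Mathlib

open Filter MeasureTheory


theorem exists_next (Ψ : ℝ → ℝ)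
    (hΨpos : ∀ x > 0, 0 < Ψ x)
    (hΨunbdd : Tendsto Ψ atTop atTop)
    (hΨo : Ψ =o[atTop] fun x => x) (q N : ℕ) :
    ∃ M : ℕ, N < M ∧ (∀ n : ℕ, 0 < n → n < M → Ψ M / M ≤ Ψ n / n) ∧
      Ψ M / M ≤ Real.exp (-(8 * q)) ∧ (0 < N → Ψ M / M ≤ Ψ N / N / 2) ∧ 2 * Ψ N ≤ Ψ M := by
  have h0 : Tendsto (fun n : ℕ => Ψ n / n) atTop (nhds 0) :=
    (hΨo.tendsto_div_nhds_zero).comp tendsto_natCast_atTop_atTop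
  have hu : Tendsto (fun n : ℕ => Ψ n) atTop atTop := hΨunbdd.comp tendsto_natCast_atTop_atTop
  have h1 : Tendsto (fun n : ℕ => (Ψ n / n)⁻¹) atTop atTop := by
    apply Tendsto.inv_tendsto_nhdsGT_zero
    rw [tendsto_nhdsWithin_iff]
    refine ⟨h0, ?_⟩
    filter_upwards [eventually_gt_atTop 0] with n hn
    have : (0:ℝ) < n := by exact_mod_cast hn
    exact div_pos (hΨpos _ this) this
  have hf := frequently_high_scores h1
  have e1 : ∀ᶠ n : ℕ in atTop, Ψ n / n ≤ Real.exp (-(8 * q)) :=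
    h0.eventually_le_const (Real.exp_pos _)
  have e2 : ∀ᶠ n : ℕ in atTop, (0 < N → Ψ n / n ≤ Ψ N / N / 2) := by
    by_cases hN : 0 < N
    · have : (0:ℝ) < N := by exact_mod_cast hN
      filter_upwards [h0.eventually_le_const (half_pos (div_pos (hΨpos _ this) this))] with n hn _
      exact hn
    · exact Eventually.of_forall fun n h => absurd h hN
  have e3 := hu.eventually_ge_atTop (2 * Ψ N)
  obtain ⟨M, hM, h1, h2, h3, h4⟩ :=
    (hf.and_eventually (e1.and (e2.and (e3.and (eventually_gt_atTop N))))).exists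
  refine ⟨M, h4, ?_, h1, h2, h3⟩
  intro n hn hnM
  have a := hM n hnM
  have : (0:ℝ) < n := by exact_mod_cast hn
  have hMp : (0:ℝ) < M := by exact_mod_cast (hn.trans hnM)
  exact ((inv_lt_inv₀ (div_pos (hΨpos _ this) this) (div_pos (hΨpos _ hMp) hMp)).1 a).le

theorem exists_seq (Ψ : ℝ → ℝ)
    (hΨpos : ∀ x > 0, 0 < Ψ x)
    (hΨunbdd : Tendsto Ψ atTop atTop)
    (hΨo : Ψ =o[atTop] fun x => x) :
    ∃ q N : ℕ → ℕ, q 0 = 1 ∧ (∀ j, q (j+1) = 4 * q j * N j) ∧ (∀ j, 0 < N j) ∧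
      (∀ j, N j < N (j+1)) ∧
      (∀ j, ∀ n : ℕ, 0 < n → n < N j → Ψ (N j) / N j ≤ Ψ n / n) ∧
      (∀ j, Ψ (N j) / N j ≤ Real.exp (-(8 * q j))) ∧
      (∀ j, Ψ (N (j+1)) / N (j+1) ≤ Ψ (N j) / N j / 2) ∧
      (∀ j, 2 * Ψ (N j) ≤ Ψ (N (j+1))) := by
  choose F hF1 hF2 hF3 hF4 hF5 using exists_next Ψ hΨpos hΨunbdd hΨo
  let s : ℕ → ℕ × ℕ := fun j => Nat.rec (1, F 1 0)
    (fun _ p => (4 * p.1 * p.2, F (4 * p.1 * p.2) p.2)) j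
  have hs : ∀ j, s (j+1) = (4 * (s j).1 * (s j).2, F (4 * (s j).1 * (s j).2) (s j).2) :=
    fun j => rfl
  have h0 : s 0 = (1, F 1 0) := rfl
  have hN : ∀ j, ∃ M, (s j).2 = F (s j).1 M := by
    intro j
    cases j with
    | zero => exact ⟨0, rfl⟩
    | succ j => exact ⟨(s j).2, rfl⟩
  have hpos : ∀ j, 0 < (s j).2 := by
    intro j
    obtain ⟨M, hM⟩ := hN j
    rw [hM]
    exact lt_of_le_of_lt (Nat.zero_le _) (hF1 _ M)
  refine ⟨fun j => (s j).1, fun j => (s j).2, rfl, fun j => rfl, hpos,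
    fun j => hF1 _ _, ?_, ?_, fun j => hF4 _ _ (hpos j), fun j => hF5 _ _⟩
  · intro j
    obtain ⟨M, hM⟩ := hN j
    simp only [hM]
    exact hF2 _ _
  · intro j
    obtain ⟨M, hM⟩ := hN j
    simp only [hM]
    exact hF3 _ _

theorem exists_alpha (q N : ℕ → ℕ) (h0 : q 0 = 1) (hq : ∀ j, q (j+1) = 4 * q j * N j)
    (hN : ∀ j, 0 < N j) :
    ∃ α : ℝ, ∀ j, ∃ p : ℤ, ∃ θ : ℝ, q j * α = p + θ ∧ 1 / (4 * N j) ≤ θ ∧ θ ≤ 1 / (2 * N j) := by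
  have hqp : ∀ j, 0 < q j := by
    intro j
    induction j with
    | zero => omega
    | succ j ih => rw [hq]; have := hN j; positivity
  have hqpR : ∀ j, (0:ℝ) < q j := fun j => by exact_mod_cast hqp j
  have hgrow : ∀ j i, ((q (i + j) : ℝ))⁻¹ ≤ (q j : ℝ)⁻¹ * (1/2)^i := by
    intro j i
    induction i with
    | zero => simp
    | succ i ih =>
      have h1 : (q (i + 1 + j) : ℝ) = 4 * q (i+j) * N (i+j) := by
        rw [show i + 1 + j = (i + j) + 1 by ring, hq]; push_cast; ring
      have h2 : (1:ℝ) ≤ N (i+j) := by exact_mod_cast hN (i+j)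
      have h3 : 2 * (q (i+j) : ℝ) ≤ q (i+1+j) := by
        rw [h1]; nlinarith [hqpR (i+j)]
      calc ((q (i + 1 + j) : ℝ))⁻¹ ≤ (2 * (q (i+j) : ℝ))⁻¹ :=
            inv_anti₀ (by have := hqpR (i+j); positivity) h3
        _ = (q (i+j) : ℝ)⁻¹ * (1/2) := by rw [mul_inv]; ring
        _ ≤ (q j : ℝ)⁻¹ * (1/2)^i * (1/2) := by gcongr
        _ = _ := by ring
  have hsg : Summable (fun i : ℕ => ((1:ℝ)/2)^i) := summable_geometric_two
  have hsum : Summable (fun j => (q j : ℝ)⁻¹) := by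
    refine Summable.of_nonneg_of_le (fun j => by positivity) (fun j => ?_) (hsg.mul_left ((q 0 : ℝ)⁻¹))
    simpa using hgrow 0 j
  refine ⟨∑' j, (q j : ℝ)⁻¹, fun j => ?_⟩
  have hint : ∀ j, ∃ p : ℤ, (q j : ℝ) * ∑ i ∈ Finset.range (j+1), (q i : ℝ)⁻¹ = p := by
    intro j
    induction j with
    | zero => exact ⟨1, by simp [h0]⟩
    | succ j ih =>
      obtain ⟨p, hp⟩ := ih
      refine ⟨4 * N j * p + 1, ?_⟩
      rw [Finset.sum_range_succ, mul_add, mul_inv_cancel₀ (hqpR _).ne', hq]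
      push_cast
      rw [← hp]; ring
  obtain ⟨p, hp⟩ := hint j
  refine ⟨p, q j * ∑' i, (q (i + (j+1)) : ℝ)⁻¹, ?_, ?_, ?_⟩
  · rw [← hp, ← mul_add, hsum.sum_add_tsum_nat_add (j+1)]
  · have hs := (summable_nat_add_iff (j+1)).2 hsum
    have := hs.le_tsum 0 (fun i _ => by positivity)
    have e : (1:ℝ) / (4 * N j) = q j * (q (0 + (j+1)) : ℝ)⁻¹ := by
      rw [zero_add, hq]; push_cast
      have := hqpR j
      have : (0:ℝ) < N j := by exact_mod_cast hN j
      field_simp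
    rw [e]
    gcongr
  · have hs := (summable_nat_add_iff (j+1)).2 hsum
    have h1 := hs.tsum_le_tsum (fun i => hgrow (j+1) i) (hsg.mul_left _)
    rw [tsum_mul_left, tsum_geometric_two] at h1
    have e : (1:ℝ) / (2 * N j) = q j * ((q (j+1) : ℝ)⁻¹ * 2) := by
      rw [hq]; push_cast
      have := hqpR j
      have : (0:ℝ) < N j := by exact_mod_cast hN j
      field_simp; norm_num
    rw [e]
    gcongr


theorem iteratedDeriv_cos_aux (A ω : ℝ) (m : ℕ) : ∀ β : ℝ,
    ∃ γ, iteratedDeriv m (fun x : ℝ => A * Real.cos (ω * x + β))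
      = fun x => A * ω ^ m * Real.cos (ω * x + γ) := by
  induction m with
  | zero => intro β; exact ⟨β, by simp⟩
  | succ m ih =>
    intro β
    obtain ⟨γ, h⟩ := ih β
    refine ⟨γ + Real.pi / 2, ?_⟩
    rw [iteratedDeriv_succ, h]
    funext x
    have : HasDerivAt (fun x => A * ω ^ m * Real.cos (ω * x + γ))
        (A * ω ^ m * (-Real.sin (ω * x + γ) * (ω * 1))) x :=
      ((((hasDerivAt_id x).const_mul ω).add_const γ).cos).const_mul _
    rw [this.deriv, ← add_assoc, Real.cos_add_pi_div_two]
    ring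

set_option maxHeartbeats 1000000 in
theorem final_step (Ψ : ℝ → ℝ)
    (hΨpos : ∀ x > 0, 0 < Ψ x)
    (hΨunbdd : Tendsto Ψ atTop atTop)
    (k : ℕ) (α C : ℝ) (φ φ' : ℝ → ℝ) (hφ : ContDiff ℝ (⊤ : ℕ∞) φ)
    (hd : ∀ x, HasDerivAt φ (φ' x) x) (hper : ∀ (x : ℝ) (p : ℤ), φ (x + p) = φ x)
    (hup : ∀ (n : ℕ) (x : ℝ), 0 < n → |∑ i ∈ Finset.range n, φ' (x + i * α)| ≤ C * Ψ n)
    (hlo : ∀ M : ℕ, ∃ n : ℕ, M ≤ n ∧ 0 < n ∧ Ψ n ≤ |∑ i ∈ Finset.range n, φ' (0 + i * α)|) :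
    ∃ f g : ℝ × ℝ × (Fin k → ℝ) → ℝ × ℝ × (Fin k → ℝ),
      ContDiff ℝ (⊤ : ℕ∞) f ∧ ContDiff ℝ (⊤ : ℕ∞) g ∧
      Function.LeftInverse g f ∧ Function.RightInverse g f ∧
      MeasurePreserving f volume volume ∧
      (∀ (x y : ℝ) (u : Fin k → ℝ) (p q : ℤ),
        f (x + p, y + q, u)
          = ((f (x, y, u)).1 + p, (f (x, y, u)).2.1 + q, (f (x, y, u)).2.2)) ∧
      0 < Filter.limsup
          (fun n : ℕ =>
            (((max (⨆ p : ℝ × ℝ × (Fin k → ℝ), ‖fderiv ℝ (f^[n]) p‖)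
                   (⨆ p : ℝ × ℝ × (Fin k → ℝ), ‖fderiv ℝ (g^[n]) p‖))
              / Ψ n : ℝ) : EReal))
          atTop ∧
      Filter.limsup
          (fun n : ℕ =>
            (((max (⨆ p : ℝ × ℝ × (Fin k → ℝ), ‖fderiv ℝ (f^[n]) p‖)
                   (⨆ p : ℝ × ℝ × (Fin k → ℝ), ‖fderiv ℝ (g^[n]) p‖))
              / Ψ n : ℝ) : EReal))
          atTop < ⊤ := by
  let E := ℝ × ℝ × (Fin k → ℝ)
  -- derivative bounds for a general skew shift
  have key : ∀ (a s : ℝ) (σ : ℝ → ℝ) (p : E), HasDerivAt σ s p.1 →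
      HasFDerivAt (fun p : E => ((p.1 + a, p.2.1 + σ p.1, p.2.2) : E))
        ((ContinuousLinearMap.fst ℝ ℝ (ℝ × (Fin k → ℝ))).prod
          (((ContinuousLinearMap.fst ℝ ℝ (Fin k → ℝ)).comp
              (ContinuousLinearMap.snd ℝ ℝ (ℝ × (Fin k → ℝ)))
            + s • ContinuousLinearMap.fst ℝ ℝ (ℝ × (Fin k → ℝ))).prod
           ((ContinuousLinearMap.snd ℝ ℝ (Fin k → ℝ)).comp
              (ContinuousLinearMap.snd ℝ ℝ (ℝ × (Fin k → ℝ)))))) p := by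
    intro a s σ p h
    have h1 : HasFDerivAt (fun p : E => p.1) (ContinuousLinearMap.fst ℝ ℝ (ℝ × (Fin k → ℝ))) p :=
      hasFDerivAt_fst
    have h2 : HasFDerivAt (fun p : E => p.2)
      (ContinuousLinearMap.snd ℝ ℝ (ℝ × (Fin k → ℝ))) p := hasFDerivAt_snd
    exact (h1.add_const a).prodMk ((h2.fst.add (h.comp_hasFDerivAt p h1)).prodMk h2.snd)
  have keyU : ∀ (a s : ℝ) (σ : ℝ → ℝ) (p : E), HasDerivAt σ s p.1 →
      ‖fderiv ℝ (fun p : E => ((p.1 + a, p.2.1 + σ p.1, p.2.2) : E)) p‖ ≤ 1 + |s| := by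
    intro a s σ p h
    rw [(key a s σ p h).fderiv]
    refine ContinuousLinearMap.opNorm_le_bound _ (by positivity) ?_
    rintro ⟨x, y, u⟩
    have hx : |x| ≤ ‖((x, y, u) : E)‖ := norm_fst_le ((x, y, u) : E)
    have hyu : ‖(y, u)‖ ≤ ‖((x, y, u) : E)‖ := norm_snd_le ((x, y, u) : E)
    have hy : |y| ≤ ‖((x, y, u) : E)‖ := (norm_fst_le (y, u)).trans hyu
    have hu : ‖u‖ ≤ ‖((x, y, u) : E)‖ := (norm_snd_le (y, u)).trans hyu
    set R := ‖((x, y, u) : E)‖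
    have hR : 0 ≤ R := norm_nonneg _
    have hsR : 0 ≤ |s| * R := by positivity
    change ‖((x, y + s * x, u) : E)‖ ≤ _
    rw [Prod.norm_mk, Prod.norm_mk, Real.norm_eq_abs, Real.norm_eq_abs]
    refine max_le (by linarith) (max_le ?_ (by linarith))
    calc |y + s * x| ≤ |y| + |s| * |x| := by rw [← abs_mul]; exact abs_add_le _ _
      _ ≤ R + |s| * R := by gcongr
      _ = _ := by ring
  have keyL : ∀ (a s : ℝ) (σ : ℝ → ℝ) (p : E), HasDerivAt σ s p.1 →
      |s| ≤ ‖fderiv ℝ (fun p : E => ((p.1 + a, p.2.1 + σ p.1, p.2.2) : E)) p‖ := by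
    intro a s σ p h
    rw [(key a s σ p h).fderiv]
    set L := ((ContinuousLinearMap.fst ℝ ℝ (ℝ × (Fin k → ℝ))).prod
          (((ContinuousLinearMap.fst ℝ ℝ (Fin k → ℝ)).comp
              (ContinuousLinearMap.snd ℝ ℝ (ℝ × (Fin k → ℝ)))
            + s • ContinuousLinearMap.fst ℝ ℝ (ℝ × (Fin k → ℝ))).prod
           ((ContinuousLinearMap.snd ℝ ℝ (Fin k → ℝ)).comp
              (ContinuousLinearMap.snd ℝ ℝ (ℝ × (Fin k → ℝ)))))) with hL
    have h1 := L.le_opNorm ((1, 0, 0) : E)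
    have h2 : L ((1, 0, 0) : E) = ((1, s, 0) : E) := by simp [hL]
    have h3 : ‖((1, 0, 0) : E)‖ = 1 := by simp [Prod.norm_mk]
    rw [h2, h3, mul_one] at h1
    refine le_trans ?_ h1
    exact (norm_fst_le ((s, 0) : ℝ × (Fin k → ℝ))).trans (norm_snd_le ((1, s, 0) : E))
  let f : E → E := fun p => (p.1 + α, p.2.1 + φ p.1, p.2.2)
  let g : E → E := fun p => (p.1 + -α, p.2.1 + -φ (p.1 + -α), p.2.2)
  have hfn : ∀ n : ℕ, f^[n] = fun p : E =>
      ((p.1 + n * α, p.2.1 + ∑ i ∈ Finset.range n, φ (p.1 + i * α), p.2.2) : E) := by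
    intro n
    induction n with
    | zero => funext p; simp
    | succ n ih =>
      rw [Function.iterate_succ', ih]
      funext p
      simp only [Function.comp, f, Finset.sum_range_succ]
      push_cast
      refine Prod.ext ?_ (Prod.ext ?_ rfl) <;> simp only <;> ring
  have hgn : ∀ n : ℕ, g^[n] = fun p : E =>
      ((p.1 + -(n * α), p.2.1 + -∑ i ∈ Finset.range n, φ (p.1 + -(n * α) + i * α), p.2.2) : E) := by
    intro n
    induction n with
    | zero => funext p; simp
    | succ n ih =>
      rw [Function.iterate_succ, ih]
      funext p
      simp only [Function.comp, g, Finset.sum_range_succ]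
      have e : p.1 + -α + -(n * α) = p.1 + -((n + 1 : ℕ) * α) := by push_cast; ring
      have e2 : p.1 + -((n + 1 : ℕ) * α) + n * α = p.1 + -α := by push_cast; ring
      rw [e, e2]
      refine Prod.ext rfl (Prod.ext ?_ rfl)
      simp only; ring
  have hS : ∀ (n : ℕ) (b x : ℝ), HasDerivAt (fun x => ∑ i ∈ Finset.range n, φ (x + b + i * α))
      (∑ i ∈ Finset.range n, φ' (x + b + i * α)) x := by
    intro n b x
    refine HasDerivAt.fun_sum fun i _ => ?_
    have := (hd (x + b + i * α)).comp_add_const (x + b) (i * α)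
    exact this.comp_add_const x b
  have hS0 : ∀ (n : ℕ) (x : ℝ), HasDerivAt (fun x => ∑ i ∈ Finset.range n, φ (x + i * α))
      (∑ i ∈ Finset.range n, φ' (x + i * α)) x := by
    intro n x
    simpa using hS n 0 x
  have hfU : ∀ n : ℕ, 0 < n → ∀ p, ‖fderiv ℝ (f^[n]) p‖ ≤ 1 + C * Ψ n := by
    intro n hn p
    rw [hfn]
    have h1 := keyU (n * α) _ _ p (hS0 n p.1)
    have h2 := hup n p.1 hn
    exact h1.trans (by linarith)
  have hgU : ∀ n : ℕ, 0 < n → ∀ p, ‖fderiv ℝ (g^[n]) p‖ ≤ 1 + C * Ψ n := by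
    intro n hn p
    rw [hgn]
    have h1 := keyU (-(n * α)) (-∑ i ∈ Finset.range n, φ' (p.1 + -(n * α) + i * α))
      (fun x => -∑ i ∈ Finset.range n, φ (x + -(n * α) + i * α)) p
      (hS n (-(n * α)) p.1).fun_neg
    rw [abs_neg] at h1
    have h2 := hup n (p.1 + -(n * α)) hn
    exact h1.trans (by linarith)
  have hfL : ∀ n : ℕ, 0 < n →
      |∑ i ∈ Finset.range n, φ' (0 + i * α)| ≤ ⨆ p : E, ‖fderiv ℝ (f^[n]) p‖ := by
    intro n hn
    have hb : BddAbove (Set.range fun p : E => ‖fderiv ℝ (f^[n]) p‖) := by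
      refine ⟨1 + C * Ψ n, ?_⟩
      rintro _ ⟨p, rfl⟩
      exact hfU n hn p
    have h1 := le_ciSup hb ((0, 0, 0) : E)
    refine le_trans ?_ h1
    have h2 := keyL (n * α) (∑ i ∈ Finset.range n, φ' (0 + i * α))
      (fun x => ∑ i ∈ Finset.range n, φ (x + i * α)) ((0, 0, 0) : E) (hS0 n 0)
    simp only [hfn]
    exact h2
  refine ⟨f, g, ?_, ?_, ?_, ?_, ?_, ?_, ?_, ?_⟩
  · exact (contDiff_fst.add contDiff_const).prodMk
      ((contDiff_snd.fst.add (hφ.comp contDiff_fst)).prodMk contDiff_snd.snd)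
  · exact (contDiff_fst.add contDiff_const).prodMk
      ((contDiff_snd.fst.add (hφ.comp (contDiff_fst.add contDiff_const)).neg).prodMk
        contDiff_snd.snd)
  · intro p
    simp [f, g]
  · intro p
    simp [f, g]
  · have hm : Measurable φ := hφ.continuous.measurable
    have := (measurePreserving_add_right (volume : Measure ℝ) α).skew_product
      (μc := (volume : Measure (ℝ × (Fin k → ℝ)))) (μd := volume)
      (g := fun x p => (p.1 + φ x, p.2))
      (by unfold Function.uncurry; fun_prop)
      (Eventually.of_forall fun x =>
        ((measurePreserving_add_right (volume : Measure ℝ) (φ x)).prod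
          (MeasurePreserving.id (volume : Measure (Fin k → ℝ)))).map_eq)
    exact this
  · intro x y u p q
    simp only [f, hper]
    refine Prod.ext ?_ (Prod.ext ?_ rfl) <;> simp only <;> ring
  · refine lt_of_lt_of_le (b := ((1:ℝ) : EReal)) (by norm_num) ?_
    refine le_limsup_of_frequently_le' ?_
    rw [frequently_atTop]
    intro M
    obtain ⟨n, hn, hn0, h⟩ := hlo M
    refine ⟨n, hn, ?_⟩
    rw [EReal.coe_le_coe_iff, le_div_iff₀ (hΨpos _ (by exact_mod_cast hn0)), one_mul]
    exact h.trans ((hfL n hn0).trans (le_max_left _ _))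
  · refine lt_of_le_of_lt (b := ((1 + C:ℝ) : EReal)) ?_ (EReal.coe_lt_top _)
    refine limsup_le_of_le (by isBoundedDefault) ?_
    have hu : Tendsto (fun n : ℕ => Ψ n) atTop atTop := hΨunbdd.comp tendsto_natCast_atTop_atTop
    filter_upwards [eventually_gt_atTop 0, hu.eventually_ge_atTop 1] with n hn h1
    rw [EReal.coe_le_coe_iff, div_le_iff₀ (by linarith)]
    refine (max_le (ciSup_le (hfU n hn)) (ciSup_le (hgU n hn))).trans ?_
    linarith

set_option maxHeartbeats 1000000 in
theorem exists_phi (Ψ : ℝ → ℝ)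
    (hΨpos : ∀ x > 0, 0 < Ψ x) (hΨmono : Monotone Ψ)
    (q N : ℕ → ℕ) (h0 : q 0 = 1) (hq : ∀ j, q (j+1) = 4 * q j * N j) (hN : ∀ j, 0 < N j)
    (hNs : ∀ j, N j < N (j+1))
    (hrec : ∀ j, ∀ n : ℕ, 0 < n → n < N j → Ψ (N j) / N j ≤ Ψ n / n)
    (hexp : ∀ j, Ψ (N j) / N j ≤ Real.exp (-(8 * q j)))
    (hhalf : ∀ j, Ψ (N (j+1)) / N (j+1) ≤ Ψ (N j) / N j / 2)
    (hdbl : ∀ j, 2 * Ψ (N j) ≤ Ψ (N (j+1)))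
    (α : ℝ) (hα : ∀ j, ∃ p : ℤ, ∃ θ : ℝ, q j * α = p + θ ∧ 1 / (4 * N j) ≤ θ ∧ θ ≤ 1 / (2 * N j)) :
    ∃ (C : ℝ) (φ φ' : ℝ → ℝ), ContDiff ℝ (⊤ : ℕ∞) φ ∧
    (∀ x, HasDerivAt φ (φ' x) x) ∧ (∀ (x : ℝ) (p : ℤ), φ (x + p) = φ x) ∧
    (∀ (n : ℕ) (x : ℝ), 0 < n → |∑ i ∈ Finset.range n, φ' (x + i * α)| ≤ C * Ψ n) ∧
    (∀ M : ℕ, ∃ n : ℕ, M ≤ n ∧ 0 < n ∧ Ψ n ≤ |∑ i ∈ Finset.range n, φ' (0 + i * α)|) := by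
  choose p θ hθ hθl hθu using hα
  have hNR : ∀ j, (0:ℝ) < N j := fun j => by exact_mod_cast hN j
  have hP : ∀ j, 0 < Ψ (N j) := fun j => hΨpos _ (hNR j)
  have hqj : ∀ j, j + 1 ≤ q j := by
    intro j
    induction j with
    | zero => omega
    | succ j ih => rw [hq]; have := hN j; nlinarith
  have hqR : ∀ j, (0:ℝ) < q j := fun j => by
    have := hqj j
    exact_mod_cast (by omega : 0 < q j)
  have hθp : ∀ j, 0 < θ j := fun j => lt_of_lt_of_le (by have := hNR j; positivity) (hθl j)
  have hpi := Real.pi_pos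
  let ω : ℕ → ℝ := fun j => 2 * Real.pi * q j
  have hω : ∀ j, 0 < ω j := fun j => by have := hqR j; positivity
  let A : ℕ → ℝ := fun j => 2 * (Ψ (N j) / ω j) * Real.sin (ω j * α / 2)
  let φj : ℕ → ℝ → ℝ := fun j x => A j * Real.cos (ω j * x + ω j * α / 2)
  let T : ℕ → ℕ → ℝ → ℝ := fun n j x =>
    Ψ (N j) * (Real.cos (ω j * (x + n * α)) - Real.cos (ω j * x))
  -- reduction of angles
  have hred : ∀ (n j : ℕ) (x : ℝ),
      Real.cos (ω j * (x + n * α)) = Real.cos (ω j * x + 2 * Real.pi * (n * θ j)) := by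
    intro n j x
    rw [← Real.cos_add_int_mul_two_pi (ω j * x + 2 * Real.pi * (n * θ j)) (n * p j)]
    congr 1
    have e : ω j * (x + n * α) = ω j * x + 2 * Real.pi * (n * (q j * α)) := by
      simp only [ω]; ring
    rw [e, hθ]; push_cast; ring
  have hA : ∀ j, |A j| ≤ Real.exp (-(8 * q j)) := by
    intro j
    have e : ω j * α / 2 = Real.pi * θ j + p j * Real.pi := by
      have : ω j * α / 2 = Real.pi * (q j * α) := by simp only [ω]; ring
      rw [this, hθ]; ring
    have h1 : |Real.sin (ω j * α / 2)| ≤ Real.pi * θ j := by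
      rw [e, Real.sin_add_int_mul_pi, abs_mul, abs_zpow, abs_neg, abs_one, one_zpow, one_mul]
      refine Real.abs_sin_le_abs.trans (le_of_eq (abs_of_pos ?_))
      have := hθp j; positivity
    have hc : 0 < 2 * (Ψ (N j) / ω j) := by have := hP j; have := hω j; positivity
    have hq1 : (1:ℝ) ≤ q j := by have := hqj j; exact_mod_cast (by omega : 1 ≤ q j)
    calc |A j| = 2 * (Ψ (N j) / ω j) * |Real.sin (ω j * α / 2)| := by
          simp only [A]; rw [abs_mul, abs_of_pos hc]
      _ ≤ 2 * (Ψ (N j) / ω j) * (Real.pi * (1 / (2 * N j))) := by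
          gcongr; exact h1.trans (by gcongr; exact hθu j)
      _ = Ψ (N j) / N j / (2 * q j) := by
          simp only [ω]; have := hqR j; have := hNR j; field_simp
      _ ≤ Ψ (N j) / N j := by
          apply div_le_self (by have := hP j; have := hNR j; positivity); linarith
      _ ≤ _ := hexp j
  have hAm : ∀ (m j : ℕ), |A j * ω j ^ m| ≤ m.factorial * Real.exp (-(j : ℝ)) := by
    intro m j
    have hq1 : (j:ℝ) ≤ q j := by have := hqj j; exact_mod_cast (by omega : j ≤ q j)
    have h7 : ω j ≤ 7 * q j := by
      simp only [ω]; have := Real.pi_lt_d2; have := hqR j; nlinarith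
    have h8 : (7 * (q j:ℝ)) ^ m ≤ m.factorial * Real.exp (7 * q j) := by
      have := Real.pow_div_factorial_le_exp (x := 7 * (q j : ℝ)) (by positivity) m
      rw [div_le_iff₀ (by positivity)] at this
      linarith
    rw [abs_mul, abs_of_pos (pow_pos (hω j) m)]
    calc |A j| * ω j ^ m ≤ Real.exp (-(8 * q j)) * (7 * q j) ^ m := by
          refine mul_le_mul (hA j) ?_ (pow_nonneg (hω j).le m) (Real.exp_pos _).le
          exact pow_le_pow_left₀ (hω j).le h7 m
      _ ≤ Real.exp (-(8 * q j)) * (m.factorial * Real.exp (7 * q j)) := by gcongr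
      _ = m.factorial * Real.exp (-(q j : ℝ)) := by
          rw [mul_left_comm, ← Real.exp_add]; congr 2; ring
      _ ≤ _ := by gcongr
  have hse : Summable (fun j : ℕ => Real.exp (-(j:ℝ))) := Real.summable_exp_neg_nat
  have hcd : ContDiff ℝ (⊤ : ℕ∞) (fun x => ∑' j, φj j x) := by
    refine contDiff_tsum (f := φj) (N := ⊤) (v := fun m j => m.factorial * Real.exp (-(j : ℝ))) ?_ ?_ ?_
    · intro j
      simp only [φj]; fun_prop
    · intro m _
      exact hse.mul_left _
    · intro m j x _
      rw [norm_iteratedFDeriv_eq_norm_iteratedDeriv]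
      obtain ⟨γ, hγ⟩ := iteratedDeriv_cos_aux (A j) (ω j) m (ω j * α / 2)
      simp only [φj]
      rw [hγ, Real.norm_eq_abs, abs_mul]
      exact (mul_le_of_le_one_right (abs_nonneg _) (Real.abs_cos_le_one _)).trans (hAm m j)
  have hdj : ∀ j x, HasDerivAt (φj j) (T 1 j x) x := by
    intro j x
    have : HasDerivAt (φj j) (A j * (-Real.sin (ω j * x + ω j * α / 2) * (ω j * 1))) x :=
      ((((hasDerivAt_id x).const_mul (ω j)).add_const (ω j * α / 2)).cos).const_mul _
    convert this using 1
    simp only [T, A]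
    rw [Real.cos_sub_cos]
    have e1 : (ω j * (x + (1:ℕ) * α) + ω j * x) / 2 = ω j * x + ω j * α / 2 := by
      push_cast; ring
    have e2 : (ω j * (x + (1:ℕ) * α) - ω j * x) / 2 = ω j * α / 2 := by
      push_cast; ring
    rw [e1, e2]
    have := (hω j).ne'
    field_simp
  -- bounds for T
  have hT1 : ∀ n j x, |T n j x| ≤ 2 * Ψ (N j) := by
    intro n j x
    simp only [T]
    rw [abs_mul, abs_of_pos (hP j), mul_comm]
    have h1 := Real.abs_cos_le_one (ω j * (x + n * α))
    have h2 := Real.abs_cos_le_one (ω j * x)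
    have h3 := abs_sub (Real.cos (ω j * (x + n * α))) (Real.cos (ω j * x))
    have := hP j
    gcongr
    linarith
  have hT2 : ∀ n j x, |T n j x| ≤ Real.pi * n * (Ψ (N j) / N j) := by
    intro n j x
    simp only [T]
    rw [abs_mul, abs_of_pos (hP j), hred]
    have h1 := Real.abs_cos_sub_cos_le (ω j * x + 2 * Real.pi * (n * θ j)) (ω j * x)
    have := hθp j
    have := hP j
    have := hNR j
    have h2 : 0 ≤ 2 * Real.pi * (n * θ j) := by positivity
    rw [add_sub_cancel_left, abs_of_nonneg h2] at h1
    have h3 : 2 * Real.pi * (n * θ j) ≤ 2 * Real.pi * (n * (1 / (2 * N j))) := by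
      gcongr; exact hθu j
    calc _ ≤ Ψ (N j) * (2 * Real.pi * (n * (1 / (2 * N j)))) :=
          mul_le_mul_of_nonneg_left (h1.trans h3) (hP j).le
      _ = _ := by field_simp
  have hdec : ∀ J i, Ψ (N (i + J)) / N (i + J) ≤ Ψ (N J) / N J * (1/2)^i := by
    intro J i
    induction i with
    | zero => simp
    | succ i ih =>
      have := hhalf (i + J)
      rw [show i + 1 + J = i + J + 1 by ring, pow_succ]
      linarith
  have hsg : Summable (fun i : ℕ => ((1:ℝ)/2)^i) := summable_geometric_two
  have hsT : ∀ n x, Summable (fun j => |T n j x|) := by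
    intro n x
    refine Summable.of_nonneg_of_le (fun j => abs_nonneg _) (fun j => ?_)
      ((hsg.mul_left (Ψ (N 0) / N 0)).mul_left (Real.pi * n))
    refine (hT2 n j x).trans ?_
    gcongr
    simpa using hdec 0 j
  have hsT' : ∀ n x, Summable (fun j => T n j x) := fun n x => (hsT n x).of_abs
  have hder : ∀ x, HasDerivAt (fun x => ∑' j, φj j x) (∑' j, T 1 j x) x := by
    intro x
    refine hasDerivAt_tsum (u := fun j => Real.pi * (1:ℕ) * (Ψ (N 0) / N 0 * (1/2)^j)) (y₀ := 0)
      ((hsg.mul_left (Ψ (N 0) / N 0)).mul_left _) hdj ?_ ?_ x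
    · intro j y
      refine (hT2 1 j y).trans ?_
      gcongr
      simpa using hdec 0 j
    · refine Summable.of_norm_bounded (g := fun j : ℕ => (Nat.factorial 0 : ℝ) * Real.exp (-(j:ℝ)))
        (hse.mul_left _) fun j => ?_
      simp only [φj]
      rw [Real.norm_eq_abs, abs_mul]
      have := hAm 0 j
      rw [pow_zero, mul_one] at this
      exact (mul_le_of_le_one_right (abs_nonneg _) (Real.abs_cos_le_one _)).trans this
  have hsum : ∀ n x, ∑ i ∈ Finset.range n, ∑' j, T 1 j (x + i * α) = ∑' j, T n j x := by
    intro n x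
    rw [← Summable.tsum_finsetSum (fun i _ => hsT' 1 _)]
    congr 1
    funext j
    have := Finset.sum_range_sub (fun i : ℕ => Ψ (N j) * Real.cos (ω j * (x + i * α))) n
    simp only [T]
    rw [mul_sub]
    convert this using 1
    · refine Finset.sum_congr rfl fun i _ => ?_
      rw [mul_sub]
      congr 4
      push_cast; ring
    · simp
  have hNge : ∀ j, j ≤ N j := fun j => (strictMono_nat_of_lt_succ hNs).le_apply
  refine ⟨4 + 2 * Real.pi, fun x => ∑' j, φj j x, fun x => ∑' j, T 1 j x, hcd, hder, ?_, ?_, ?_⟩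
  · intro x m
    refine tsum_congr fun j => ?_
    simp only [φj]
    congr 1
    rw [← Real.cos_add_int_mul_two_pi (ω j * x + ω j * α / 2) (q j * m)]
    congr 1
    simp only [ω]; push_cast; ring
  · intro n x hn
    rw [hsum]
    have hnR : (0:ℝ) < n := by exact_mod_cast hn
    have hPn := hΨpos _ hnR
    have hex : ∃ J, n < N J := ⟨n + 1, lt_of_lt_of_le (Nat.lt_succ_self n) (hNge _)⟩
    obtain ⟨J, hJ, hJmin⟩ : ∃ J, n < N J ∧ ∀ j < J, N j ≤ n := by
      classical
      exact ⟨Nat.find hex, Nat.find_spec hex, fun j hj => not_lt.1 (Nat.find_min hex hj)⟩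
    have hhead : ∑ j ∈ Finset.range J, |T n j x| ≤ 4 * Ψ n := by
      have hg : ∀ m, ∑ j ∈ Finset.range (m + 1), Ψ (N j) ≤ 2 * Ψ (N m) := by
        intro m
        induction m with
        | zero => simp; linarith [hP 0]
        | succ m ih => rw [Finset.sum_range_succ]; linarith [hdbl m]
      cases J with
      | zero => simp; linarith
      | succ m =>
        calc _ ≤ ∑ j ∈ Finset.range (m+1), 2 * Ψ (N j) := Finset.sum_le_sum fun j _ => hT1 n j x
          _ = 2 * ∑ j ∈ Finset.range (m+1), Ψ (N j) := by rw [Finset.mul_sum]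
          _ ≤ 2 * (2 * Ψ (N m)) := by gcongr; exact hg m
          _ ≤ 2 * (2 * Ψ n) := by
              gcongr
              exact hΨmono (by exact_mod_cast hJmin m (Nat.lt_succ_self m))
          _ = _ := by ring
    have htail : ∑' i, |T n (i + J) x| ≤ 2 * Real.pi * Ψ n := by
      have hle : ∀ i, |T n (i + J) x| ≤ Real.pi * Ψ n * (1/2)^i := by
        intro i
        calc _ ≤ Real.pi * n * (Ψ (N (i+J)) / N (i+J)) := hT2 n (i+J) x
          _ ≤ Real.pi * n * (Ψ n / n * (1/2)^i) := by
              gcongr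
              exact (hdec J i).trans
                (mul_le_mul_of_nonneg_right (hrec J n hn hJ) (by positivity))
          _ = _ := by field_simp
      have := ((summable_nat_add_iff J).2 (hsT n x)).tsum_le_tsum hle (hsg.mul_left _)
      rw [tsum_mul_left, tsum_geometric_two] at this
      linarith
    have h1 : |∑' j, T n j x| ≤ ∑' j, |T n j x| := by
      have := norm_tsum_le_tsum_norm (f := fun j => T n j x) (by simpa only [Real.norm_eq_abs] using hsT n x)
      simpa only [Real.norm_eq_abs] using this
    rw [← (hsT n x).sum_add_tsum_nat_add J] at h1
    linarith
  · intro M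
    refine ⟨N M, hNge M, hN M, ?_⟩
    rw [hsum]
    have hneg : ∀ j, 0 ≤ - T (N M) j 0 := by
      intro j
      simp only [T]
      have := Real.cos_le_one (ω j * (0 + N M * α))
      rw [mul_zero, Real.cos_zero]
      nlinarith [hP j]
    have h1 := (hsT' (N M) 0).neg.le_tsum M (fun j _ => hneg j)
    rw [tsum_neg] at h1
    refine le_trans ?_ (h1.trans (neg_le_abs _))
    have hc : Real.cos (ω M * (0 + N M * α)) ≤ 0 := by
      rw [hred, mul_zero, zero_add]
      have := hNR M
      have a1 : (1:ℝ) / 4 ≤ N M * θ M := by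
        calc (1:ℝ)/4 = N M * (1 / (4 * N M)) := by field_simp
          _ ≤ _ := by gcongr; exact hθl M
      have a2 : N M * θ M ≤ (1:ℝ) / 2 := by
        calc _ ≤ N M * (1 / (2 * (N M:ℝ))) := by gcongr; exact hθu M
          _ = _ := by field_simp
      apply Real.cos_nonpos_of_pi_div_two_le_of_le <;> nlinarith
    simp only [T]
    rw [mul_zero, Real.cos_zero]
    nlinarith [hP M]

/-- Coordinate form of the main theorem for `𝕋² × ℝᵏ`: for every admissible `Ψ` and
every `k ≥ 0` there is a smooth, Lebesgue-measure-preserving diffeomorphism `f` of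
`ℝ^{2+k}` commuting with integer translations in the first two coordinates whose
growth sequence `Γ_n(f)` satisfies `0 < limsup Γ_n(f)/Ψ(n) < ∞`. -/
theorem slow_volume_preserving_diffeo_exists
    (Ψ : ℝ → ℝ)
    (hΨpos : ∀ x > 0, 0 < Ψ x)
    (hΨmono : Monotone Ψ)
    (hΨunbdd : Tendsto Ψ atTop atTop)
    (hΨo : Ψ =o[atTop] fun x => x)
    (k : ℕ) :
    ∃ f g : ℝ × ℝ × (Fin k → ℝ) → ℝ × ℝ × (Fin k → ℝ),
      ContDiff ℝ (⊤ : ℕ∞) f ∧ ContDiff ℝ (⊤ : ℕ∞) g ∧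
      Function.LeftInverse g f ∧ Function.RightInverse g f ∧
      MeasurePreserving f volume volume ∧
      (∀ (x y : ℝ) (u : Fin k → ℝ) (p q : ℤ),
        f (x + p, y + q, u)
          = ((f (x, y, u)).1 + p, (f (x, y, u)).2.1 + q, (f (x, y, u)).2.2)) ∧
      0 < Filter.limsup
          (fun n : ℕ =>
            (((max (⨆ p : ℝ × ℝ × (Fin k → ℝ), ‖fderiv ℝ (f^[n]) p‖)
                   (⨆ p : ℝ × ℝ × (Fin k → ℝ), ‖fderiv ℝ (g^[n]) p‖))
              / Ψ n : ℝ) : EReal))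
          atTop ∧
      Filter.limsup
          (fun n : ℕ =>
            (((max (⨆ p : ℝ × ℝ × (Fin k → ℝ), ‖fderiv ℝ (f^[n]) p‖)
                   (⨆ p : ℝ × ℝ × (Fin k → ℝ), ‖fderiv ℝ (g^[n]) p‖))
              / Ψ n : ℝ) : EReal))
          atTop < ⊤ := by
  obtain ⟨q, N, h0, hq, hN, hNs, hrec, hexp, hhalf, hdbl⟩ := exists_seq Ψ hΨpos hΨunbdd hΨo
  obtain ⟨α, hα⟩ := exists_alpha q N h0 hq hN
  obtain ⟨C, φ, φ', hφ, hd, hper, hup, hlo⟩ :=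
    exists_phi Ψ hΨpos hΨmono q N h0 hq hN hNs hrec hexp hhalf hdbl α hα
  exact final_step Ψ hΨpos hΨunbdd k α C φ φ' hφ hd hper hup hlo
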